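/- arXiv:1310.3194 — 4 statements merged into one kernel-verified Lean document; each statement's English description precedes it below -/
import Mathlib

section
/- For every initial point (y₁₀, y₂₀) ∈ ℝ², setting T = |y₁₀| + |y₁₀/2 + y₂₀/π|, there exist a piecewise-constant function u: [0,T] → ℝ taking at most two values, each of absolute value at most π, and an absolutely continuous function y = (y₁,y₂): [0,T] → ℝ² such that y₁′(t) = sin(u(t)) and y₂′(t) = u(t)·cos(2u(t)) for almost every t ∈ [0,T], y(0) = (y₁₀,y₂₀), and y(T) = (0,0). -/
open MeasureTheory

/-- The integral over `[0, T]` of a function that is constant on `[0, τ)` and on `[τ, T]`. -/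
theorem integral_piecewise_const (a b τ T : ℝ) (h0 : 0 ≤ τ) (h1 : τ ≤ T) :
    ∫ s in (0 : ℝ)..T, (if s < τ then a else b) = τ * a + (T - τ) * b := by
  have hleft : Set.EqOn (fun _ : ℝ => a) (fun s => if s < τ then a else b) (Set.Ioo 0 τ) :=
    fun s hs => by simp [hs.2]
  have hright : Set.EqOn (fun _ : ℝ => b) (fun s => if s < τ then a else b) (Set.Ioo τ T) :=
    fun s hs => by simp [hs.1.le]
  have ileft : IntervalIntegrable (fun s => if s < τ then a else b) volume 0 τ :=
    intervalIntegrable_const.congr_uIoo (by rwa [Set.uIoo_of_le h0])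
  have iright : IntervalIntegrable (fun s => if s < τ then a else b) volume τ T :=
    intervalIntegrable_const.congr_uIoo (by rwa [Set.uIoo_of_le h1])
  rw [← intervalIntegral.integral_add_adjacent_intervals ileft iright,
    ← intervalIntegral.integral_congr_Ioo_of_le h0 hleft,
    ← intervalIntegral.integral_congr_Ioo_of_le h1 hright]
  simp

theorem exists_sign_mul_eq_abs (x : ℝ) : ∃ σ : ℝ, (σ = 1 ∨ σ = -1) ∧ |x| * σ = x := by
  rcases abs_cases x with h | h
  · exact ⟨1, Or.inl rfl, by linarith⟩
  · exact ⟨-1, Or.inr rfl, by linarith⟩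

/-- For the system `ẏ₁ = sin u`, `ẏ₂ = u cos 2u`, every initial point `(y₁₀, y₂₀)` can be
steered to the origin in time `T = |y₁₀| + |y₁₀/2 + y₂₀/π|` by a piecewise-constant control
taking at most two values, each of absolute value at most `π`; the trajectory is absolutely
continuous (encoded by the integral identities). -/
theorem stmt10 (y10 y20 T : ℝ) (hT : T = |y10| + |y10 / 2 + y20 / Real.pi|) :
    ∃ u : ℝ → ℝ, ∃ y : ℝ → ℝ × ℝ, ∃ c1 c2 t1 : ℝ,
      |c1| ≤ Real.pi ∧ |c2| ≤ Real.pi ∧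
      0 ≤ t1 ∧ t1 ≤ T ∧
      (∀ t, 0 ≤ t → t < t1 → u t = c1) ∧
      (∀ t, t1 ≤ t → t ≤ T → u t = c2) ∧
      (∀ t ∈ Set.Icc (0 : ℝ) T,
        y t = (y10 + ∫ s in (0:ℝ)..t, Real.sin (u s),
               y20 + ∫ s in (0:ℝ)..t, u s * Real.cos (2 * u s))) ∧
      y 0 = (y10, y20) ∧ y T = (0, 0) := by
  obtain ⟨σ, hσ, hσx⟩ := exists_sign_mul_eq_abs y10
  obtain ⟨ρ, hρ, hρz⟩ := exists_sign_mul_eq_abs (y10 / 2 + y20 / Real.pi)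
  have hπ := Real.pi_pos
  set c1 : ℝ := -σ * (Real.pi / 2) with hc1
  set c2 : ℝ := -ρ * Real.pi with hc2
  have b1 : |c1| ≤ Real.pi := by
    rw [abs_le]; rcases hσ with rfl | rfl <;> constructor <;> linarith
  have b2 : |c2| ≤ Real.pi := by
    rw [abs_le]; rcases hρ with rfl | rfl <;> constructor <;> linarith
  have s1 : Real.sin c1 = -σ := by rcases hσ with rfl | rfl <;> simp [hc1]
  have s2 : Real.sin c2 = 0 := by rcases hρ with rfl | rfl <;> simp [hc2]
  have d1 : Real.cos (2 * c1) = -1 := by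
    have h : 2 * c1 = -σ * Real.pi := by rw [hc1]; ring
    rw [h]; rcases hσ with rfl | rfl <;> simp
  have d2 : Real.cos (2 * c2) = 1 := by
    have h : 2 * c2 = -ρ * (2 * Real.pi) := by rw [hc2]; ring
    rw [h]; rcases hρ with rfl | rfl <;> simp
  have hτ : |y10| ≤ T := by rw [hT]; linarith [abs_nonneg (y10 / 2 + y20 / Real.pi)]
  have hTτ : T - |y10| = |y10 / 2 + y20 / Real.pi| := by rw [hT]; ring
  refine ⟨fun t => if t < |y10| then c1 else c2, fun t =>
    (y10 + ∫ s in (0:ℝ)..t, Real.sin (if s < |y10| then c1 else c2),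
      y20 + ∫ s in (0:ℝ)..t, (if s < |y10| then c1 else c2) *
        Real.cos (2 * (if s < |y10| then c1 else c2))),
    c1, c2, |y10|, b1, b2, abs_nonneg _, hτ, fun t _ h => if_pos h,
    fun t h _ => if_neg h.not_gt, fun _ _ => rfl, by simp, ?_⟩
  have e1 : ∀ s : ℝ, Real.sin (if s < |y10| then c1 else c2) =
      if s < |y10| then -σ else 0 := fun s => by split_ifs <;> assumption
  have e2 : ∀ s : ℝ, (if s < |y10| then c1 else c2) *
      Real.cos (2 * (if s < |y10| then c1 else c2)) =
      if s < |y10| then -c1 else c2 := fun s => by split_ifs <;> simp [d1, d2]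
  simp only [e1, e2, integral_piecewise_const _ _ _ _ (abs_nonneg y10) hτ, hTτ]
  refine Prod.ext ?_ ?_
  · change y10 + (|y10| * -σ + |y10 / 2 + y20 / Real.pi| * 0) = 0
    linarith
  · change y20 + (|y10| * -c1 + |y10 / 2 + y20 / Real.pi| * c2) = 0
    have hz : (y10 / 2 + y20 / Real.pi) * Real.pi = y10 * Real.pi / 2 + y20 := by
      field_simp
    rw [hc1, hc2]
    linear_combination (Real.pi / 2) * hσx - Real.pi * hρz - hz
end

section
/- For every integer n ≥ 1, the origin 0 ∈ ℝⁿ belongs to the interior of the convex hull of the set Φ([−1,1]) = { (u, u³, u⁵, …, u^{2n−1}) : u ∈ [−1, 1] } ⊂ ℝⁿ. -/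
open scoped Pointwise in
/-- If a subset of a finite-dimensional space is symmetric about the origin and spans the space,
then the origin is an interior point of its convex hull. -/
theorem zero_mem_interior_convexHull_of_neg_eq {V : Type*} [NormedAddCommGroup V]
    [NormedSpace ℝ V] [FiniteDimensional ℝ V] {s : Set V} (h0 : (0 : V) ∈ s) (hneg : -s = s)
    (hspan : Submodule.span ℝ s = ⊤) : (0 : V) ∈ interior (convexHull ℝ s) := by
  have haff : affineSpan ℝ s = ⊤ := by
    refine SetLike.coe_injective ?_
    rw [← Set.insert_eq_of_mem h0, affineSpan_insert_zero, hspan]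
    simp
  obtain ⟨x, hx⟩ := interior_convexHull_nonempty_iff_affineSpan_eq_top.mpr haff
  have hnx : -x ∈ interior (convexHull ℝ s) := by
    rw [← hneg, convexHull_neg, ← Set.image_neg_eq_neg, ← Homeomorph.coe_neg,
      ← Homeomorph.image_interior]
    exact ⟨x, hx, rfl⟩
  simpa using (convex_convexHull ℝ s).interior.midpoint_mem hx hnx

/-- The odd moment curve, restricted to an infinite set of parameters, spans `ℝⁿ`. -/
theorem span_oddMomentCurve_image (n : ℕ) {t : Set ℝ} (ht : t.Infinite) :
    Submodule.span ℝ ((fun u : ℝ => fun i : Fin n => u ^ (2 * (i : ℕ) + 1)) '' t) = ⊤ := by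
  by_contra hne
  obtain ⟨f, hf, hker⟩ := Submodule.exists_le_ker_of_lt_top _ (lt_top_iff_ne_top.mpr hne)
  let p : Polynomial ℝ :=
    ∑ i : Fin n, Polynomial.monomial (2 * (i : ℕ) + 1) (f (Pi.single i 1))
  have hp : p = 0 := by
    refine Polynomial.eq_zero_of_infinite_isRoot p (ht.mono fun u hu => ?_)
    have hfu := LinearMap.mem_ker.mp (hker (Submodule.subset_span (Set.mem_image_of_mem _ hu)))
    rw [LinearMap.pi_apply_eq_sum_univ] at hfu
    simp only [Set.mem_ofPred_eq, Polynomial.IsRoot.def, p, Polynomial.eval_finsetSum,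
      Polynomial.eval_monomial]
    rw [← hfu]
    refine Finset.sum_congr rfl fun i _ => ?_
    rw [smul_eq_mul, mul_comm]
    congr 2
    ext j
    simp [Pi.single_apply, eq_comm]
  refine hf (LinearMap.pi_ext' fun i => LinearMap.ext_ring ?_)
  have hcoeff := congrArg (fun q => q.coeff (2 * (i : ℕ) + 1)) hp
  simpa [p, Polynomial.finsetSum_coeff, Polynomial.coeff_monomial, Fin.val_inj] using hcoeff

/-- For every `n ≥ 1`, the origin of `ℝⁿ` belongs to the interior of the convex hull of
the odd moment curve `Φ([−1,1]) = {(u, u³, …, u^{2n−1}) : u ∈ [−1,1]}`. -/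
theorem stmt14 (n : ℕ) (hn : 1 ≤ n) :
    (0 : Fin n → ℝ) ∈ interior (convexHull ℝ
      ((fun u : ℝ => fun i : Fin n => u ^ (2 * (i : ℕ) + 1)) '' Set.Icc (-1 : ℝ) 1)) := by
  refine zero_mem_interior_convexHull_of_neg_eq ⟨0, by simp, ?_⟩ ?_
    (span_oddMomentCurve_image n (Set.Icc_infinite (by norm_num)))
  · ext i
    simp
  · have hodd (u : ℝ) : (fun i : Fin n => (-u) ^ (2 * (i : ℕ) + 1)) =
        -fun i : Fin n => u ^ (2 * (i : ℕ) + 1) :=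
      funext fun i => (odd_two_mul_add_one (i : ℕ)).neg_pow u
    ext x
    constructor
    · rintro ⟨u, hu, hux⟩
      exact ⟨-u, ⟨by linarith [hu.2], by linarith [hu.1]⟩, by simp only [hodd, hux, neg_neg]⟩
    · rintro ⟨u, hu, rfl⟩
      exact ⟨-u, ⟨by linarith [hu.2], by linarith [hu.1]⟩, hodd u⟩
end

section
/- For every integer n ≥ 1 and every initial point x₀ ∈ ℝⁿ, there exist T ≥ 0, a piecewise-constant function u: [0,T] → [−1, 1], and an absolutely continuous function x: [0,T] → ℝⁿ such that xᵢ′(t) = u(t)^{2i−1} for i = 1, …, n for almost every t ∈ [0,T], x(0) = x₀, and x(T) = 0. That is, the system ẋ₁ = u, ẋ₂ = u³, …, ẋ_n = u^{2n−1} with constraint |u| ≤ 1 is globally null-controllable in finite time by piecewise-constant controls. -/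
open MeasureTheory

theorem exists_sum_odd_pow_eq (n : ℕ) (y : Fin n → ℝ) :
    ∃ c : ℕ → ℝ, ∀ i : Fin n,
      ∑ k ∈ Finset.range n, c k * (1 / ((k : ℝ) + 1)) ^ (2 * (i : ℕ) + 1) = y i := by
  set v : Fin n → ℝ := fun k => (1 / ((k : ℝ) + 1)) ^ 2 with hv
  have hinj : Function.Injective v := by
    intro a b hab
    have h1 : (1 / ((a : ℝ) + 1)) = 1 / ((b : ℝ) + 1) :=
      (pow_left_inj₀ (by positivity) (by positivity) two_ne_zero).1 hab
    have ha : (0 : ℝ) < (a : ℝ) + 1 := by positivity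
    have hb : (0 : ℝ) < (b : ℝ) + 1 := by positivity
    field_simp at h1
    have h2 : ((a : ℕ) : ℝ) = (b : ℕ) := by linarith
    exact Fin.ext (by exact_mod_cast h2)
  have hdet : IsUnit (Matrix.vandermonde v).det :=
    (Matrix.det_vandermonde_ne_zero_iff.2 hinj).isUnit
  set d := Matrix.vecMul y (Matrix.vandermonde v)⁻¹ with hd
  have hdy : Matrix.vecMul d (Matrix.vandermonde v) = y := by
    rw [hd, Matrix.vecMul_vecMul, Matrix.nonsing_inv_mul _ hdet, Matrix.vecMul_one]
  refine ⟨fun k => if h : k < n then d ⟨k, h⟩ * ((k : ℝ) + 1) else 0, fun i => ?_⟩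
  rw [Finset.sum_range]
  conv_rhs => rw [← hdy]
  simp only [Matrix.vecMul, dotProduct, Matrix.vandermonde_apply, Fin.is_lt, dite_true, Fin.eta]
  refine Finset.sum_congr rfl fun k _ => ?_
  have hk : (k : ℝ) + 1 ≠ 0 := by positivity
  simp only [hv]
  rw [← pow_mul, pow_succ]
  field_simp

theorem exists_piecewise_const {τ : ℕ → ℝ} (hτ : Monotone τ) {w : ℕ → ℝ} {s : Set ℝ}
    (hs : (0 : ℝ) ∈ s) (hw : ∀ k, w k ∈ s) :
    ∃ u : ℝ → ℝ, (∀ t, u t ∈ s) ∧ ∀ j, ∀ t ∈ Set.Ico (τ j) (τ (j + 1)), u t = w j := by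
  classical
  refine ⟨fun t => if h : ∃ j, t ∈ Set.Ico (τ j) (τ (j + 1)) then w h.choose else 0, ?_, ?_⟩
  · intro t
    dsimp only
    split_ifs with h
    · exact hw _
    · exact hs
  · intro j t ht
    have h : ∃ j, t ∈ Set.Ico (τ j) (τ (j + 1)) := ⟨j, ht⟩
    have hj : h.choose = j := by
      by_contra hne
      exact Set.disjoint_left.1 (hτ.pairwise_disjoint_on_Ico_succ hne) h.choose_spec ht
    simp only [dif_pos h, hj]

theorem integral_pow_piecewise_const {τ w : ℕ → ℝ} {u : ℝ → ℝ} (hτ : Monotone τ)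
    (hu : ∀ j, ∀ t ∈ Set.Ico (τ j) (τ (j + 1)), u t = w j) (m p : ℕ) :
    ∫ t in (τ 0)..(τ m), u t ^ p = ∑ k ∈ Finset.range m, (τ (k + 1) - τ k) * w k ^ p := by
  have heq : ∀ k, Set.EqOn (fun _ => w k ^ p) (fun t => u t ^ p)
      (Set.Ioo (τ k) (τ (k + 1))) := fun k t ht => by
    simp only [hu k t (Set.Ioo_subset_Ico_self ht)]
  have hint : ∀ k < m, IntervalIntegrable (fun t => u t ^ p) volume (τ k) (τ (k + 1)) := by
    intro k _
    have h := (intervalIntegrable_const (μ := volume) (a := τ k) (b := τ (k + 1)) (c := w k ^ p))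
    rw [intervalIntegrable_iff_integrableOn_Ioo_of_le (hτ k.le_succ)] at h ⊢
    exact h.congr_fun (heq k) measurableSet_Ioo
  rw [← intervalIntegral.sum_integral_adjacent_intervals hint]
  refine Finset.sum_congr rfl fun k _ => ?_
  rw [intervalIntegral.integral_of_le (hτ k.le_succ), integral_Ioc_eq_integral_Ioo,
    ← setIntegral_congr_fun measurableSet_Ioo (heq k), ← integral_Ioc_eq_integral_Ioo,
    ← intervalIntegral.integral_of_le (hτ k.le_succ), intervalIntegral.integral_const, smul_eq_mul]

theorem abs_mul_sign_mul_pow_odd (c v : ℝ) (i : ℕ) :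
    |c| * (SignType.sign c * v) ^ (2 * i + 1) = c * v ^ (2 * i + 1) := by
  rcases lt_trichotomy c 0 with h | rfl | h
  · rw [sign_neg h, abs_of_neg h]
    simp [Odd.neg_pow (odd_two_mul_add_one i)]
  · simp
  · rw [sign_pos h, abs_of_pos h]
    simp

open MeasureTheory

/-- The system `ẋᵢ = u^{2i−1}`, `i = 1,…,n`, with constraint `|u| ≤ 1` is globally
null-controllable in finite time by piecewise-constant controls; the trajectory is
absolutely continuous (encoded by the integral identities). -/
theorem stmt16 (n : ℕ) (hn : 1 ≤ n) (x0 : Fin n → ℝ) :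
    ∃ T : ℝ, 0 ≤ T ∧ ∃ u : ℝ → ℝ,
      (∀ t, u t ∈ Set.Icc (-1 : ℝ) 1) ∧
      (∃ m : ℕ, ∃ τ : ℕ → ℝ, τ 0 = 0 ∧ τ m = T ∧
        (∀ j, j < m → τ j ≤ τ (j + 1)) ∧
        (∀ j, j < m → ∀ s t : ℝ, τ j ≤ s → s < τ (j + 1) → τ j ≤ t → t < τ (j + 1) →
          u s = u t)) ∧
      ∃ x : ℝ → Fin n → ℝ,
        x 0 = x0 ∧
        (∀ t ∈ Set.Icc (0 : ℝ) T, ∀ i : Fin n,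
          x t i = x0 i + ∫ s in (0:ℝ)..t, (u s) ^ (2 * (i : ℕ) + 1)) ∧
        x T = 0 := by
  obtain ⟨c, hc⟩ := exists_sum_odd_pow_eq n (-x0)
  set τ : ℕ → ℝ := fun j => ∑ k ∈ Finset.range j, |c k| with hτdef
  have hsucc : ∀ k, τ (k + 1) - τ k = |c k| := fun k => by
    simp [hτdef, Finset.sum_range_succ]
  have hτ : Monotone τ := monotone_nat_of_le_succ fun k => by
    linarith [hsucc k, abs_nonneg (c k)]
  have hτ0 : τ 0 = 0 := by simp [hτdef]
  have hw : ∀ k : ℕ, (SignType.sign (c k) : ℝ) * (1 / ((k : ℝ) + 1)) ∈ Set.Icc (-1 : ℝ) 1 := by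
    intro k
    have h0 : 0 ≤ 1 / ((k : ℝ) + 1) := by positivity
    have h1 : 1 / ((k : ℝ) + 1) ≤ 1 :=
      (div_le_one (by positivity)).2 (by linarith [(k.cast_nonneg : (0 : ℝ) ≤ k)])
    rcases lt_trichotomy (c k) 0 with h | h | h
    · rw [sign_neg h, SignType.coe_neg_one]
      constructor <;> linarith
    · simp [h]
    · rw [sign_pos h, SignType.coe_one]
      constructor <;> linarith
  obtain ⟨u, hu1, hu⟩ := exists_piecewise_const hτ (by simp) hw
  refine ⟨τ n, hτ0 ▸ hτ n.zero_le, u, hu1, ⟨n, τ, hτ0, rfl, fun j _ => hτ j.le_succ, ?_⟩,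
    fun t i => x0 i + ∫ s in (0 : ℝ)..t, u s ^ (2 * (i : ℕ) + 1), ?_, fun _ _ _ => rfl, ?_⟩
  · intro j _ s t hs hs' ht ht'
    rw [hu j s ⟨hs, hs'⟩, hu j t ⟨ht, ht'⟩]
  · ext i
    simp
  · ext i
    have h := integral_pow_piecewise_const hτ hu n (2 * (i : ℕ) + 1)
    simp only [hsucc, abs_mul_sign_mul_pow_odd, hc i, hτ0] at h
    simp [h]
end

section
/- Let ε⁺ > 0, ε⁻ > 0 and let (z₁₀, z₂₀) ∈ ℝ² satisfy z₂₀ < w(z₁₀), where w(z₁) = −√(2ε⁺z₁) for z₁ ≥ 0 and w(z₁) = √(−2ε⁻z₁) for z₁ < 0. Set t₁ = ( −z₂₀ + √( (z₂₀² − 2z₁₀ε⁺)·ε⁻/(ε⁺+ε⁻) ) ) / ε⁺ and T = ( −z₂₀ + √( (z₂₀² − 2z₁₀ε⁺)·(ε⁺+ε⁻)/ε⁻ ) ) / ε⁺. Then z₂₀² − 2z₁₀ε⁺ ≥ 0, 0 < t₁ ≤ T, and there exists an absolutely continuous function (z₁, z₂): [0, T] → ℝ² with z₁′(t) = z₂(t)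 for all t, z₂′(t) = ε⁺ for almost every t ∈ (0, t₁), z₂′(t) = −ε⁻ for almost every t ∈ (t₁, T), (z₁(0), z₂(0)) = (z₁₀, z₂₀), and (z₁(T), z₂(T)) = (0, 0). -/
theorem hasDerivAt_max_sub_zero_of_lt {a t : ℝ} (h : t < a) :
    HasDerivAt (fun x : ℝ => max (x - a) 0) 0 t := by
  refine (hasDerivAt_const t (0 : ℝ)).congr_of_eventuallyEq ?_
  filter_upwards [Iio_mem_nhds h] with x hx
  exact max_eq_right (sub_nonpos.2 (le_of_lt hx))

theorem hasDerivAt_max_sub_zero_of_gt {a t : ℝ} (h : a < t) :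
    HasDerivAt (fun x : ℝ => max (x - a) 0) 1 t := by
  refine ((hasDerivAt_id t).sub_const a).congr_of_eventuallyEq ?_
  filter_upwards [Ioi_mem_nhds h] with x hx
  exact max_eq_left (sub_nonneg.2 (le_of_lt hx))

theorem hasDerivAt_max_sub_zero_sq (a t : ℝ) :
    HasDerivAt (fun x : ℝ => max (x - a) 0 ^ 2) (2 * max (t - a) 0) t := by
  rcases lt_trichotomy t a with h | rfl | h
  · exact ((hasDerivAt_max_sub_zero_of_lt h).pow 2).congr_deriv (by simp [h.le])
  · have hl : HasDerivWithinAt (fun x : ℝ => max (x - t) 0 ^ 2) 0 (Set.Iic t) t :=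
      (hasDerivWithinAt_const t _ (0 : ℝ)).congr
        (fun x hx => by rw [max_eq_right (sub_nonpos.2 (Set.mem_Iic.1 hx)), zero_pow two_ne_zero]) (by simp)
    have hr : HasDerivWithinAt (fun x : ℝ => max (x - t) 0 ^ 2) 0 (Set.Ici t) t := by
      have hd : HasDerivAt (fun x : ℝ => (x - t) ^ 2) 0 t :=
        (((hasDerivAt_id t).sub_const t).pow 2).congr_deriv (by simp)
      exact hd.hasDerivWithinAt.congr
        (fun x hx => by rw [max_eq_left (sub_nonneg.2 (Set.mem_Ici.1 hx))]) (by simp)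
    have hu := hl.union hr
    rw [Set.Iic_union_Ici, hasDerivWithinAt_univ] at hu
    simpa using hu
  · exact ((hasDerivAt_max_sub_zero_of_gt h).pow 2).congr_deriv (by simp)

theorem discriminant_pos_of_lt_switching_curve {εp εm z10 z20 : ℝ} (hεp : 0 < εp) (hεm : 0 < εm)
    (h : z20 < if 0 ≤ z10 then -Real.sqrt (2 * εp * z10) else Real.sqrt (-(2 * εm * z10))) :
    0 < z20 ^ 2 - 2 * z10 * εp ∧
      z20 < Real.sqrt ((z20 ^ 2 - 2 * z10 * εp) * εm / (εp + εm)) := by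
  split_ifs at h with hz
  · have h0 := Real.sqrt_nonneg (2 * εp * z10)
    have hs := Real.sq_sqrt (show 0 ≤ 2 * εp * z10 by positivity)
    refine ⟨by nlinarith, lt_of_lt_of_le ?_ (Real.sqrt_nonneg _)⟩
    linarith
  · rw [not_le] at hz
    have hp : 0 < -z10 * εp := mul_pos (neg_pos.2 hz) hεp
    refine ⟨by nlinarith [sq_nonneg z20], ?_⟩
    rcases lt_or_ge z20 0 with hn | hn
    · exact lt_of_lt_of_le hn (Real.sqrt_nonneg _)
    · rw [Real.lt_sqrt hn] at h ⊢
      rw [lt_div_iff₀ (by positivity)]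
      nlinarith [mul_lt_mul_of_pos_right h hεp]

/-- Bang-bang steering of the double integrator `ż₁ = z₂`, `ż₂ = u` from an initial point
below the switching curve `z₂ = w(z₁)`: applying acceleration `ε⁺` up to the switching
time `t₁` and then deceleration `−ε⁻` up to time `T` brings the point to the origin. -/
theorem stmt18 (εp εm : ℝ) (hεp : 0 < εp) (hεm : 0 < εm)
    (z10 z20 : ℝ) (w : ℝ → ℝ)
    (hw : ∀ z1 : ℝ, w z1 = if 0 ≤ z1 then -Real.sqrt (2 * εp * z1)
      else Real.sqrt (-(2 * εm * z1)))
    (hbelow : z20 < w z10)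
    (t1 T : ℝ)
    (ht1 : t1 = (-z20 + Real.sqrt ((z20 ^ 2 - 2 * z10 * εp) * εm / (εp + εm))) / εp)
    (hT : T = (-z20 + Real.sqrt ((z20 ^ 2 - 2 * z10 * εp) * (εp + εm) / εm)) / εp) :
    0 ≤ z20 ^ 2 - 2 * z10 * εp ∧ 0 < t1 ∧ t1 ≤ T ∧
    ∃ z1 z2 : ℝ → ℝ,
      (∀ t ∈ Set.Icc (0 : ℝ) T, HasDerivAt z1 (z2 t) t) ∧
      ContinuousOn z2 (Set.Icc (0 : ℝ) T) ∧
      (∀ t ∈ Set.Ioo (0 : ℝ) t1, HasDerivAt z2 εp t) ∧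
      (∀ t ∈ Set.Ioo t1 T, HasDerivAt z2 (-εm) t) ∧
      z1 0 = z10 ∧ z2 0 = z20 ∧ z1 T = 0 ∧ z2 T = 0 := by
  rw [hw] at hbelow
  obtain ⟨hD, hlt⟩ := discriminant_pos_of_lt_switching_curve hεp hεm hbelow
  have hr : Real.sqrt ((z20 ^ 2 - 2 * z10 * εp) * (εp + εm) / εm) =
      Real.sqrt ((z20 ^ 2 - 2 * z10 * εp) * εm / (εp + εm)) * ((εp + εm) / εm) := by
    rw [← Real.sqrt_sq (show 0 ≤ (εp + εm) / εm by positivity), ← Real.sqrt_mul (by positivity)]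
    congr 1
    field_simp
  have hs := Real.sq_sqrt
    (show 0 ≤ (z20 ^ 2 - 2 * z10 * εp) * εm / (εp + εm) by positivity)
  rw [hr] at hT
  have hs0 := Real.sqrt_nonneg ((z20 ^ 2 - 2 * z10 * εp) * εm / (εp + εm))
  set s := Real.sqrt ((z20 ^ 2 - 2 * z10 * εp) * εm / (εp + εm))
  rw [eq_div_iff (by positivity)] at hs
  have ht1pos : 0 < t1 := by
    rw [ht1]
    exact div_pos (by linarith) hεp
  have hTt : T = t1 + s / εm := by
    rw [hT, ht1]
    field_simp
    ring
  have hle : t1 ≤ T := by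
    rw [hTt]
    exact le_add_of_nonneg_right (by positivity)
  have hmaxT : max (T - t1) 0 = s / εm := by
    rw [max_eq_left (sub_nonneg.2 hle), hTt, add_sub_cancel_left]
  have hacc : ∀ t, HasDerivAt (fun t : ℝ => z20 + εp * t) εp t := fun t => by
    simpa using ((hasDerivAt_id t).const_mul εp).const_add z20
  refine ⟨hD.le, ht1pos, hle,
    fun t => z10 + z20 * t + εp / 2 * t ^ 2 - (εp + εm) / 2 * max (t - t1) 0 ^ 2,
    fun t => z20 + εp * t - (εp + εm) * max (t - t1) 0,
    fun t _ => ?_, by fun_prop, fun t ht => ?_, fun t ht => ?_, ?_, ?_, ?_, ?_⟩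
  · exact (((((hasDerivAt_id t).const_mul z20).const_add z10).add
      (((hasDerivAt_id t).pow 2).const_mul (εp / 2))).sub
      ((hasDerivAt_max_sub_zero_sq t1 t).const_mul ((εp + εm) / 2))).congr_deriv
      (by simp; ring)
  · exact ((hacc t).sub ((hasDerivAt_max_sub_zero_of_lt ht.2).const_mul (εp + εm))).congr_deriv
      (by ring)
  · exact ((hacc t).sub ((hasDerivAt_max_sub_zero_of_gt ht.1).const_mul (εp + εm))).congr_deriv
      (by ring)
  · simp [ht1pos.le]
  · simp [ht1pos.le]
  · simp only [hmaxT]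
    rw [hTt, ht1]
    field_simp
    linear_combination εm * hs
  · simp only [hmaxT]
    rw [hTt, ht1]
    field_simp
    ring
end
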